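/- For every real μ with 0 < μ < 1, the series Σ_{t=1}^{∞} t·(t^{t−1}·(μ·e^{−μ})^{t}/(μ·t!)) converges and its sum equals 1/(1−μ). -/

import Mathlib

/-- Coefficients `n^n / n!`. -/
noncomputable def borelCoeff (n : ℕ) : ℝ := (n : ℝ) ^ n / (n.factorial : ℝ)

lemma borelCoeff_nonneg (n : ℕ) : 0 ≤ borelCoeff n := by
  unfold borelCoeff; positivity

lemma borelCoeff_le (n : ℕ) : borelCoeff n ≤ Real.exp 1 ^ n := by
  have h := Real.pow_div_factorial_le_exp (n : ℝ) (Nat.cast_nonneg n) n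
  rw [← Real.exp_nat_mul, mul_one]
  exact h

lemma borel_summable {x : ℝ} (hx0 : 0 ≤ x) (hx : x * Real.exp 1 < 1) :
    Summable (fun n : ℕ => borelCoeff n * x ^ n) := by
  refine Summable.of_nonneg_of_le (fun n => mul_nonneg (borelCoeff_nonneg n) (by positivity))
    (fun n => ?_) (summable_geometric_of_lt_one (by positivity) hx)
  rw [mul_pow, mul_comm]
  exact mul_le_mul_of_nonneg_left (borelCoeff_le n) (by positivity)

lemma borel_arg_lt {m : ℝ} (hm : m ≠ 1) : m * Real.exp (-m) * Real.exp 1 < 1 := by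
  have h := Real.add_one_lt_exp (x := m - 1) (sub_ne_zero.mpr hm)
  have h2 : m < Real.exp (m - 1) := by linarith
  have h3 : Real.exp (m - 1) * (Real.exp (-m) * Real.exp 1) = 1 := by
    rw [← Real.exp_add, ← Real.exp_add]; simp
  rw [mul_assoc]
  exact (mul_lt_mul_of_pos_right h2 (by positivity)).trans_eq h3

lemma borel_analyticAt {x : ℝ} (hx0 : 0 ≤ x) (hx : x * Real.exp 1 < 1) :
    AnalyticAt ℝ (fun y : ℝ => ∑' n : ℕ, borelCoeff n * y ^ n) x := by
  set p := FormalMultilinearSeries.ofScalars ℝ borelCoeff with hp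
  have hr : ((Real.toNNReal (Real.exp (-1)) : NNReal) : ENNReal) ≤ p.radius := by
    refine p.le_radius_of_bound 1 (fun n => ?_)
    rw [hp, FormalMultilinearSeries.ofScalars_norm, Real.norm_of_nonneg (borelCoeff_nonneg n),
      Real.coe_toNNReal _ (Real.exp_pos _).le]
    calc borelCoeff n * Real.exp (-1) ^ n ≤ Real.exp 1 ^ n * Real.exp (-1) ^ n :=
          mul_le_mul_of_nonneg_right (borelCoeff_le n) (by positivity)
      _ = 1 := by rw [← mul_pow, ← Real.exp_add]; simp
  have hxlt : x < Real.exp (-1) := by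
    rw [Real.exp_neg, ← one_div, lt_div_iff₀ (Real.exp_pos 1)]; exact hx
  have hpos : 0 < p.radius := lt_of_lt_of_le (by simp [Real.exp_pos]) hr
  have hmem : x ∈ Metric.eball (0 : ℝ) p.radius := by
    rw [Metric.mem_eball]
    refine lt_of_lt_of_le ?_ hr
    rw [edist_dist, Real.dist_eq, sub_zero, abs_of_nonneg hx0]
    exact (ENNReal.ofReal_lt_ofReal_iff (Real.exp_pos _)).2 hxlt
  have h := (p.hasFPowerSeriesOnBall hpos).analyticAt_of_mem hmem
  have he : p.sum = fun y : ℝ => ∑' n : ℕ, borelCoeff n * y ^ n := by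
    have := FormalMultilinearSeries.ofScalarsSum_eq_tsum (E := ℝ) borelCoeff
    simp only [smul_eq_mul] at this
    exact this
  rwa [he] at h

/-- The terms of the double series. -/
noncomputable def borelDouble (m : ℝ) (q : ℕ × ℕ) : ℝ :=
  borelCoeff q.1 * m ^ q.1 * ((-m * q.1) ^ q.2 / (q.2.factorial : ℝ))

lemma real_hasSum_exp (x : ℝ) : HasSum (fun n : ℕ => x ^ n / (n.factorial : ℝ)) (Real.exp x) := by
  rw [Real.exp_eq_exp_ℝ]
  exact NormedSpace.expSeries_div_hasSum_exp x

lemma borelDouble_summable {m : ℝ} (h0 : 0 < m) (h1 : m < 1 / 10) :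
    Summable (borelDouble m) := by
  refine Summable.of_norm ?_
  have hn : ∀ a b : ℕ, ‖borelDouble m (a, b)‖
      = borelCoeff a * m ^ a * ((m * a) ^ b / (b.factorial : ℝ)) := by
    intro a b
    simp only [borelDouble, norm_mul, norm_div, norm_pow, norm_neg, Real.norm_natCast,
      Real.norm_of_nonneg h0.le, Real.norm_of_nonneg (borelCoeff_nonneg a)]
  have hs : ∀ a : ℕ, HasSum (fun b => ‖borelDouble m (a, b)‖)
      (borelCoeff a * (m * Real.exp m) ^ a) := by
    intro a
    simp only [hn]
    have := (real_hasSum_exp (m * a)).mul_left (borelCoeff a * m ^ a)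
    rwa [mul_comm m (a : ℝ), Real.exp_nat_mul, mul_assoc (borelCoeff a), ← mul_pow,
      mul_comm (a : ℝ) m] at this
  rw [summable_prod_of_nonneg (fun _ => norm_nonneg _)]
  refine ⟨fun a => (hs a).summable, ?_⟩
  simp only [fun a => (hs a).tsum_eq]
  refine borel_summable (by positivity) ?_
  have e1 : Real.exp m ≤ Real.exp 1 := Real.exp_le_exp.2 (by linarith)
  have e2 : Real.exp 1 < 3 := Real.exp_one_lt_three
  have e0 := Real.exp_pos 1
  have e3 := Real.exp_pos m
  have e4 : Real.exp m * Real.exp 1 ≤ 9 := by nlinarith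
  rw [mul_assoc]
  nlinarith

lemma borel_diag (m : ℝ) (n : ℕ) :
    ∑ q ∈ Finset.HasAntidiagonal.antidiagonal n, borelDouble m q = m ^ n := by
  have h := congrFun (fwdDiff_iter_eq_factorial (R := ℝ) (n := n)) 0
  rw [fwdDiff_iter_eq_sum_shift] at h
  rw [Finset.Nat.sum_antidiagonal_eq_sum_range_succ_mk]
  have hf : (n.factorial : ℝ) ≠ 0 := by positivity
  have key : ∀ k ∈ Finset.range (n + 1), borelDouble m (k, n - k)
      = m ^ n / (n.factorial : ℝ) *
        (((-1) ^ (n - k) * (n.choose k : ℤ)) • ((0 : ℝ) + k • (1 : ℝ)) ^ n) := by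
    intro k hk
    have hk' : k ≤ n := Nat.lt_succ_iff.1 (Finset.mem_range.1 hk)
    obtain ⟨j, rfl⟩ := Nat.exists_eq_add_of_le hk'
    have hc : ((k + j).choose k : ℝ) = ((k + j).factorial : ℝ) / (k.factorial * j.factorial) := by
      rw [Nat.cast_add_choose]
    simp only [borelDouble, borelCoeff, Nat.add_sub_cancel_left, zsmul_eq_mul, nsmul_eq_mul,
      mul_one, zero_add]
    push_cast
    rw [hc]
    have a1 : (k.factorial : ℝ) ≠ 0 := by positivity
    have a2 : (j.factorial : ℝ) ≠ 0 := by positivity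
    rw [show -m * (k : ℝ) = (-1) * m * k by ring, mul_pow, mul_pow, pow_add, pow_add]
    field_simp
  rw [Finset.sum_congr rfl key, ← Finset.mul_sum, h]
  simp only [Pi.natCast_apply]
  field_simp

lemma borel_small {m : ℝ} (h0 : 0 < m) (h1 : m < 1 / 10) :
    ∑' n : ℕ, borelCoeff n * (m * Real.exp (-m)) ^ n = (1 - m)⁻¹ := by
  have hS := (borelDouble_summable h0 h1).hasSum
  have hA : HasSum (fun n : ℕ => borelCoeff n * (m * Real.exp (-m)) ^ n)
      (∑' q, borelDouble m q) := by
    refine hS.prod_fiberwise (fun a => ?_)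
    have := (real_hasSum_exp (-m * a)).mul_left (borelCoeff a * m ^ a)
    rwa [mul_comm (-m) (a : ℝ), Real.exp_nat_mul, mul_assoc (borelCoeff a), ← mul_pow,
      mul_comm (a : ℝ) (-m)] at this
  have hB : HasSum (fun n : ℕ => m ^ n) (∑' q, borelDouble m q) := by
    have h2 := (Finset.HasAntidiagonal.sigmaAntidiagonalEquivProd (A := ℕ)).hasSum_iff.2 hS
    refine h2.sigma (fun n => ?_)
    have h3 := hasSum_fintype (fun c : Finset.HasAntidiagonal.antidiagonal n => borelDouble m c)
    rw [Finset.sum_coe_sort (Finset.HasAntidiagonal.antidiagonal n) (borelDouble m), borel_diag] at h3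
    exact h3
  rw [hA.tsum_eq]
  exact hB.unique (hasSum_geometric_of_lt_one h0.le (by linarith))

lemma borel_all {m : ℝ} (hm : m ∈ Set.Ioo (0 : ℝ) 1) :
    ∑' n : ℕ, borelCoeff n * (m * Real.exp (-m)) ^ n = (1 - m)⁻¹ := by
  have hF : AnalyticOnNhd ℝ
      (fun m : ℝ => ∑' n : ℕ, borelCoeff n * (m * Real.exp (-m)) ^ n) (Set.Ioo 0 1) := by
    intro x hx
    have h1 : 0 ≤ x * Real.exp (-x) := mul_nonneg hx.1.le (Real.exp_pos _).le
    have hg : AnalyticAt ℝ (fun y : ℝ => y * Real.exp (-y)) x := by fun_prop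
    exact AnalyticAt.fun_comp (f := fun y : ℝ => y * Real.exp (-y))
      (borel_analyticAt h1 (borel_arg_lt hx.2.ne)) hg
  have hG : AnalyticOnNhd ℝ (fun m : ℝ => (1 - m)⁻¹) (Set.Ioo 0 1) := by
    intro x hx
    have : (1 : ℝ) - x ≠ 0 := by linarith [hx.2] |> fun h : 0 < 1 - x => h.ne'
    exact (analyticAt_const.sub analyticAt_id).inv this
  refine hF.eqOn_of_preconnected_of_eventuallyEq hG isPreconnected_Ioo
    (z₀ := 1 / 20) (by norm_num) ?_ hm
  have : Set.Ioo (0 : ℝ) (1 / 10) ∈ nhds (1 / 20 : ℝ) := Ioo_mem_nhds (by norm_num) (by norm_num)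
  filter_upwards [this] with y hy
  exact borel_small hy.1 hy.2



/-- The Borel(μ) distribution has mean `1/(1−μ)`: the series
`Σ_{t≥1} t·t^{t−1}(μe^{−μ})^t/(μ·t!)` converges with sum `1/(1−μ)`, for `0 < μ < 1`. -/
theorem borel_mean (mu : ℝ) (hmu : mu ∈ Set.Ioo (0 : ℝ) 1) :
    Summable (fun t : ℕ+ => ((t : ℕ) : ℝ) * (((t : ℕ) : ℝ) ^ ((t : ℕ) - 1)
        * (mu * Real.exp (-mu)) ^ (t : ℕ) / (mu * ((t : ℕ).factorial : ℝ)))) ∧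
      ∑' t : ℕ+, ((t : ℕ) : ℝ) * (((t : ℕ) : ℝ) ^ ((t : ℕ) - 1)
        * (mu * Real.exp (-mu)) ^ (t : ℕ) / (mu * ((t : ℕ).factorial : ℝ)))
        = 1 / (1 - mu) := by

  obtain ⟨h0, h1⟩ := hmu
  have hs := (borel_summable (mul_nonneg h0.le (Real.exp_pos (-mu)).le)
    (borel_arg_lt h1.ne)).hasSum
  rw [borel_all ⟨h0, h1⟩] at hs
  have hne : 1 - mu ≠ 0 := (sub_pos.2 h1).ne'
  have hval : (1 - mu)⁻¹ = mu / (1 - mu) + borelCoeff 0 * (mu * Real.exp (-mu)) ^ 0 := by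
    simp only [borelCoeff, pow_zero, Nat.factorial_zero, Nat.cast_one]
    field_simp
    ring
  rw [hval] at hs
  have hp := (hasSum_pnat_iff.2 hs).mul_left (1 / mu)
  have hlim : 1 / mu * (mu / (1 - mu)) = 1 / (1 - mu) := by field_simp
  rw [hlim] at hp
  have hfun : (fun t : ℕ+ => ((t : ℕ) : ℝ) * (((t : ℕ) : ℝ) ^ ((t : ℕ) - 1)
        * (mu * Real.exp (-mu)) ^ (t : ℕ) / (mu * ((t : ℕ).factorial : ℝ))))
      = fun t : ℕ+ => 1 / mu * (borelCoeff t * (mu * Real.exp (-mu)) ^ (t : ℕ)) := by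
    funext t
    have ht : ((t : ℕ) : ℝ) ^ (t : ℕ) = ((t : ℕ) : ℝ) * ((t : ℕ) : ℝ) ^ ((t : ℕ) - 1) :=
      (mul_pow_sub_one t.ne_zero _).symm
    have hf : ((t : ℕ).factorial : ℝ) ≠ 0 := by positivity
    simp only [borelCoeff]
    rw [ht]
    field_simp
  rw [hfun]
  exact ⟨hp.summable, hp.tsum_eq⟩
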